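/- Let K be a number field and let φ, ψ ∈ K(z) be rational functions of degree d ≥ 2. Let T_φ, T_ψ ⊂ ℙ¹(K̄) be an invariant pair for φ and ψ that is stable under the action of Gal(K̄/K). Then every element of Conj_{φ,ψ}(K) ⊂ PGL₂(K) ⊂ ℙ³(K) has relative multiplicative height at most 6^{[K:ℚ]} · (max_{τ∈T_φ} H_K(τ))³ · (max_{η∈T_ψ} H_K(η))³. -/

import Mathlib

open MvPolynomial

noncomputable section

/-- `PGL₂(R)`: the projective general linear group of 2×2 matrices. -/
abbrev PGL2 (R : Type*) [CommRing R] : Type _ :=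
  GL (Fin 2) R ⧸ Subgroup.center (GL (Fin 2) R)

/-- The class of an invertible matrix in `PGL₂`. -/
def PGL2.mk {R : Type*} [CommRing R] (M : GL (Fin 2) R) : PGL2 R :=
  QuotientGroup.mk M

/-- The pair of linear forms attached to a 2×2 matrix. -/
def linForms {R : Type*} [CommRing R] (M : Matrix (Fin 2) (Fin 2) R) :
    Fin 2 → MvPolynomial (Fin 2) R :=
  fun i => C (M i 0) * X 0 + C (M i 1) * X 1

/-- The matrix `M` conjugates the pair of binary forms `Φ` to `Ψ`,
i.e. `S ∘ Φ = λ · (Ψ ∘ S)` for some scalar `λ`, where `S` is the pair of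
linear forms of `M`.  This is the homogeneous form of `s ∘ φ ∘ s⁻¹ = ψ`. -/
def MatConj {R : Type*} [CommRing R] (Φ Ψ : Fin 2 → MvPolynomial (Fin 2) R)
    (M : GL (Fin 2) R) : Prop :=
  ∃ c : Rˣ, ∀ i,
    bind₁ Φ (linForms (M : Matrix (Fin 2) (Fin 2) R) i) =
      C (c : R) * bind₁ (linForms (M : Matrix (Fin 2) (Fin 2) R)) (Ψ i)

/-- `Conj_{φ,ψ}(R)`: the set of elements of `PGL₂(R)` conjugating `φ` to `ψ`. -/
def ConjSet {R : Type*} [CommRing R] (Φ Ψ : Fin 2 → MvPolynomial (Fin 2) R) :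
    Set (PGL2 R) :=
  {s | ∃ M : GL (Fin 2) R, PGL2.mk M = s ∧ MatConj Φ Ψ M}

/-- `Aut_φ(R)`: the automorphism group of `φ` inside `PGL₂(R)`. -/
def AutSet {R : Type*} [CommRing R] (Φ : Fin 2 → MvPolynomial (Fin 2) R) :
    Set (PGL2 R) :=
  ConjSet Φ Φ


open NumberField

/-- The relative multiplicative height `H_K` of a projective point with
coordinates in the ring of integers: the archimedean contribution divided by the
norm of the ideal generated by the coordinates (the non-archimedean
contribution). -/
noncomputable def heightVec {K : Type*} [Field K] [NumberField K]
    {ι : Type*} [Fintype ι] [Nonempty ι] (x : ι → 𝓞 K) : ℝ :=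
  (∏ w : InfinitePlace K,
      (Finset.univ.sup' Finset.univ_nonempty
        fun i => w (algebraMap (𝓞 K) K (x i))) ^ w.mult) /
    (Ideal.absNorm (Ideal.span (Set.range x)) : ℝ)

section Helpers

/-- The archimedean part of the height as a product over embeddings. -/
lemma hb_prod_places {K : Type*} [Field K] [NumberField K] (f : InfinitePlace K → ℝ) :
    ∏ w : InfinitePlace K, f w ^ w.mult = ∏ φ : K →+* ℂ, f (InfinitePlace.mk φ) := by
  classical
  rw [← Finset.prod_fiberwise (s := Finset.univ) (g := fun φ : K →+* ℂ => InfinitePlace.mk φ)]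
  refine Finset.prod_congr rfl fun w _ => ?_
  rw [Finset.prod_congr rfl (g := fun _ => f w), Finset.prod_const,
    InfinitePlace.card_filter_mk_eq]
  intro φ hφ
  rw [(Finset.mem_filter.1 hφ).2]

lemma hb_card_ext {K L : Type*} [Field K] [NumberField K] [Field L] [NumberField L]
    [Algebra K L] [DecidableEq (K →+* ℂ)] (ψ : K →+* ℂ) :
    (Finset.univ.filter fun φ : L →+* ℂ => φ.comp (algebraMap K L) = ψ).card
      = Module.finrank K L := by
  let _ : Algebra K ℂ := ψ.toAlgebra
  rw [← AlgHom.card K L ℂ, ← Fintype.card_subtype]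
  refine Fintype.card_congr
    { toFun := fun φ => { φ.1 with commutes' := fun r => RingHom.congr_fun φ.2 r }
      invFun := fun g => ⟨g.toRingHom, RingHom.ext fun r => g.commutes r⟩
      left_inv := fun φ => by ext; rfl
      right_inv := fun g => by ext; rfl }

lemma hb_arch_base {K L : Type*} [Field K] [NumberField K] [Field L] [NumberField L]
    [Algebra K L] (f : InfinitePlace K → ℝ) :
    ∏ w : InfinitePlace L, f (w.comap (algebraMap K L)) ^ w.mult =
      (∏ w : InfinitePlace K, f w ^ w.mult) ^ Module.finrank K L := by
  classical
  rw [hb_prod_places (K := K), hb_prod_places (K := L) (fun w => f (w.comap (algebraMap K L))),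
    ← Finset.prod_fiberwise (s := Finset.univ)
      (g := fun φ : L →+* ℂ => φ.comp (algebraMap K L)), ← Finset.prod_pow]
  refine Finset.prod_congr rfl fun ψ _ => ?_
  rw [Finset.prod_congr rfl (g := fun _ => f (InfinitePlace.mk ψ)), Finset.prod_const]
  · congr 1
    convert hb_card_ext (L := L) ψ
  intro φ hφ
  rw [InfinitePlace.comap_mk, (Finset.mem_filter.1 hφ).2]

lemma hb_base {K L : Type*} [Field K] [NumberField K] [Field L] [NumberField L]
    [Algebra K L] {ι : Type*} [Fintype ι] [Nonempty ι] (x : ι → 𝓞 K) :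
    heightVec (fun i => algebraMap (𝓞 K) (𝓞 L) (x i)) =
      heightVec x ^ Module.finrank K L := by
  unfold heightVec
  rw [div_pow]
  congr 1
  · rw [← hb_arch_base (K := K) (L := L) (fun w => Finset.univ.sup' Finset.univ_nonempty
        fun i => w (algebraMap (𝓞 K) K (x i)))]
    rfl
  · rw [← Nat.cast_pow]
    congr 1
    have := Ideal.absNorm_algebraMap (R := 𝓞 K) (𝓞 L) (Ideal.span (Set.range x))
    rw [Ideal.map_span, ← Set.range_comp] at this
    have hfr := IsFractionRing.finrank_eq (𝓞 K) K (𝓞 L) L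
    rw [hfr]
    exact this

lemma hb_smul {K : Type*} [Field K] [NumberField K] {ι : Type*} [Fintype ι] [Nonempty ι]
    (x : ι → 𝓞 K) (a : 𝓞 K) (ha : a ≠ 0) :
    heightVec (fun i => a * x i) = heightVec x := by
  unfold heightVec
  have h1 : Ideal.span (Set.range fun i => a * x i) =
      Ideal.span {a} * Ideal.span (Set.range x) := by
    rw [Ideal.span_mul_span', Set.singleton_mul, ← Set.range_comp]
    rfl
  have h2 : ∀ w : InfinitePlace K, (Finset.univ.sup' Finset.univ_nonempty
      fun i => w (algebraMap (𝓞 K) K (a * x i))) = w (algebraMap (𝓞 K) K a) *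
      (Finset.univ.sup' Finset.univ_nonempty fun i => w (algebraMap (𝓞 K) K (x i))) := by
    intro w
    rw [Finset.mul₀_sup' (apply_nonneg w _)]
    simp only [map_mul]
  have h3 : ∏ w : InfinitePlace K, w (algebraMap (𝓞 K) K a) ^ w.mult =
      (Ideal.absNorm (Ideal.span {a}) : ℝ) := by
    rw [InfinitePlace.prod_eq_abs_norm, Ideal.absNorm_span_singleton]
    rw [← Algebra.coe_norm_int]
    simp
  have h4 : (Ideal.absNorm (Ideal.span {a}) : ℝ) ≠ 0 := by
    rw [Nat.cast_ne_zero, Ne, Ideal.absNorm_eq_zero_iff]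
    simpa using ha
  rw [Finset.prod_congr rfl (fun w _ => congrArg (· ^ w.mult) (h2 w)), h1]
  simp only [mul_pow, Finset.prod_mul_distrib, h3, map_mul, Nat.cast_mul]
  rw [mul_div_mul_left _ _ h4]

lemma hb_nonneg {K : Type*} [Field K] [NumberField K] {ι : Type*} [Fintype ι] [Nonempty ι]
    (x : ι → 𝓞 K) : 0 ≤ heightVec x := by
  unfold heightVec
  refine div_nonneg (Finset.prod_nonneg fun w _ => pow_nonneg ?_ _) (Nat.cast_nonneg _)
  exact Finset.le_sup'_of_le _ (Finset.mem_univ (Classical.arbitrary ι)) (apply_nonneg w _)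

lemma hb_le {K : Type*} [Field K] [NumberField K] {ι : Type*} [Fintype ι] [Nonempty ι]
    (m : ι → 𝓞 K) (hm : m ≠ 0) (c : ℝ) (F : InfinitePlace K → ℝ) (I : Ideal (𝓞 K))
    (h : ∀ w i, w (algebraMap (𝓞 K) K (m i)) ≤ c * F w) (hI : ∀ i, m i ∈ I) :
    heightVec m ≤ c ^ Module.finrank ℚ K * (∏ w, F w ^ w.mult) / (Ideal.absNorm I : ℝ) := by
  have hle : Ideal.span (Set.range m) ≤ I := by
    rw [Ideal.span_le]; rintro _ ⟨i, rfl⟩; exact hI i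
  have hm0 : Ideal.span (Set.range m) ≠ ⊥ := by
    intro h0
    apply hm
    funext i
    have : m i ∈ Ideal.span (Set.range m) := Ideal.subset_span ⟨i, rfl⟩
    rw [h0] at this
    simpa using this
  have hI0 : I ≠ ⊥ := fun h0 => hm0 (le_bot_iff.1 (h0 ▸ hle))
  have hIpos : 0 < Ideal.absNorm I := Nat.pos_of_ne_zero fun h => hI0 (Ideal.absNorm_eq_zero_iff.1 h)
  have hmpos : 0 < Ideal.absNorm (Ideal.span (Set.range m)) :=
    Nat.pos_of_ne_zero fun h => hm0 (Ideal.absNorm_eq_zero_iff.1 h)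
  have hnorm : Ideal.absNorm I ≤ Ideal.absNorm (Ideal.span (Set.range m)) :=
    Nat.le_of_dvd hmpos (Ideal.absNorm_dvd_absNorm_of_le hle)
  have hs : ∀ w : InfinitePlace K, 0 ≤ (Finset.univ.sup' Finset.univ_nonempty
        fun i => w (algebraMap (𝓞 K) K (m i))) := fun w =>
    Finset.le_sup'_of_le _ (Finset.mem_univ (Classical.arbitrary ι)) (apply_nonneg w _)
  have harch : (∏ w : InfinitePlace K, (Finset.univ.sup' Finset.univ_nonempty
        fun i => w (algebraMap (𝓞 K) K (m i))) ^ w.mult) ≤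
      c ^ Module.finrank ℚ K * (∏ w, F w ^ w.mult) := by
    rw [← InfinitePlace.sum_mult_eq, ← Finset.prod_pow_eq_pow_sum, ← Finset.prod_mul_distrib]
    refine Finset.prod_le_prod (fun w _ => pow_nonneg (hs w) _) fun w _ => ?_
    rw [← mul_pow]
    exact pow_le_pow_left₀ (hs w) (Finset.sup'_le _ _ fun i _ => h w i) _
  unfold heightVec
  have hp : 0 ≤ (∏ w : InfinitePlace K, (Finset.univ.sup' Finset.univ_nonempty
        fun i => w (algebraMap (𝓞 K) K (m i))) ^ w.mult) :=
    Finset.prod_nonneg fun w _ => pow_nonneg (hs w) _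
  exact div_le_div₀ (hp.trans harch) harch (by exact_mod_cast hIpos) (by exact_mod_cast hnorm)

/-- Row of the linear system expressing that `S τ` is proportional to `η`. -/
def hbRow {R : Type*} [CommRing R] (t e : Fin 2 → R) : Fin 2 × Fin 2 → R :=
  fun p => if p.1 = 0 then t p.2 * e 1 else -(t p.2 * e 0)

/-- A `3 × 3` minor. -/
def hbDet {R : Type*} [CommRing R] {ι : Type*} (x y z : ι → R) (p q r : ι) : R :=
  x p * y q * z r - x p * y r * z q - x q * y p * z r + x q * y r * z p
    + x r * y p * z q - x r * y q * z p

/-- The vector of signed minors of the `3 × 4` system. -/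
def hbMin {R : Type*} [CommRing R] (x y z : Fin 2 × Fin 2 → R) : Fin 2 × Fin 2 → R :=
  fun p => if p.1 = 0 then
      (if p.2 = 0 then hbDet x y z (0, 1) (1, 0) (1, 1) else -hbDet x y z (0, 0) (1, 0) (1, 1))
    else (if p.2 = 0 then hbDet x y z (0, 0) (0, 1) (1, 1) else -hbDet x y z (0, 0) (0, 1) (1, 0))

/-- The bracket of two vectors. -/
def hbBr {R : Type*} [CommRing R] (s t : Fin 2 → R) : R := s 0 * t 1 - s 1 * t 0

lemma hbMin_map {R S : Type*} [CommRing R] [CommRing S] (f : R →+* S)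
    (t₁ t₂ t₃ e₁ e₂ e₃ : Fin 2 → R) (p : Fin 2 × Fin 2) :
    f (hbMin (hbRow t₁ e₁) (hbRow t₂ e₂) (hbRow t₃ e₃) p) =
      hbMin (hbRow (fun i => f (t₁ i)) (fun i => f (e₁ i)))
        (hbRow (fun i => f (t₂ i)) (fun i => f (e₂ i)))
        (hbRow (fun i => f (t₃ i)) (fun i => f (e₃ i))) p := by
  obtain ⟨i, j⟩ := p
  fin_cases i <;> fin_cases j <;> simp [hbMin, hbRow, hbDet]

lemma hbMin_identity {R : Type*} [CommRing R] (S : Matrix (Fin 2) (Fin 2) R)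
    (t₁ t₂ t₃ e₁ e₂ e₃ : Fin 2 → R) (c₁ c₂ c₃ : R)
    (h₁ : S.mulVec t₁ = c₁ • e₁) (h₂ : S.mulVec t₂ = c₂ • e₂) (h₃ : S.mulVec t₃ = c₃ • e₃)
    (p : Fin 2 × Fin 2) :
    c₁ * c₂ * c₃ * hbMin (hbRow t₁ e₁) (hbRow t₂ e₂) (hbRow t₃ e₃) p =
      (S.det * hbBr t₁ t₂ * hbBr t₁ t₃ * hbBr t₂ t₃) * S p.1 p.2 := by
  have k : ∀ (t e : Fin 2 → R) (c : R), S.mulVec t = c • e → ∀ i,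
      c * e i = S i 0 * t 0 + S i 1 * t 1 := by
    intro t e c h i
    have := congrFun h i
    simp [Matrix.mulVec, dotProduct, Fin.sum_univ_two] at this
    exact this.symm
  have a0 := k _ _ _ h₁ 0
  have a1 := k _ _ _ h₁ 1
  have b0 := k _ _ _ h₂ 0
  have b1 := k _ _ _ h₂ 1
  have d0 := k _ _ _ h₃ 0
  have d1 := k _ _ _ h₃ 1
  have hrow : ∀ (t e : Fin 2 → R) (c : R) (q), c * hbRow t e q = hbRow t (c • e) q := by
    intro t e c q
    unfold hbRow
    split_ifs <;> simp <;> ring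
  have hmin : c₁ * c₂ * c₃ * hbMin (hbRow t₁ e₁) (hbRow t₂ e₂) (hbRow t₃ e₃) p =
      hbMin (fun q => c₁ * hbRow t₁ e₁ q) (fun q => c₂ * hbRow t₂ e₂ q)
        (fun q => c₃ * hbRow t₃ e₃ q) p := by
    unfold hbMin hbDet
    split_ifs <;> ring
  rw [hmin]
  simp only [hrow]
  obtain ⟨i, j⟩ := p
  fin_cases i <;> fin_cases j <;>
    simp [hbMin, hbRow, hbDet, hbBr, Matrix.det_fin_two, a0, a1, b0, b1, d0, d1] <;> ring

lemma hb_minors {K : Type*} [Field K] [NumberField K] (t₁ t₂ t₃ e₁ e₂ e₃ : Fin 2 → 𝓞 K)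
    (hm : hbMin (hbRow t₁ e₁) (hbRow t₂ e₂) (hbRow t₃ e₃) ≠ 0) :
    heightVec (hbMin (hbRow t₁ e₁) (hbRow t₂ e₂) (hbRow t₃ e₃)) ≤
      6 ^ Module.finrank ℚ K * (heightVec t₁ * heightVec t₂ * heightVec t₃) *
        (heightVec e₁ * heightVec e₂ * heightVec e₃) := by
  let sp : (Fin 2 → 𝓞 K) → Ideal (𝓞 K) := fun t => Ideal.span (Set.range t)
  let su : (Fin 2 → 𝓞 K) → InfinitePlace K → ℝ := fun t w =>
    Finset.univ.sup' Finset.univ_nonempty fun i => w (algebraMap (𝓞 K) K (t i))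
  have hsu : ∀ t w i, w (algebraMap (𝓞 K) K (t i)) ≤ su t w := fun t w i =>
    Finset.le_sup' (fun i => w (algebraMap (𝓞 K) K (t i))) (Finset.mem_univ i)
  have hsu0 : ∀ t w, 0 ≤ su t w := fun t w => (apply_nonneg w _).trans (hsu t w 0)
  have hrow : ∀ t e w q, w (algebraMap (𝓞 K) K (hbRow t e q)) ≤ su t w * su e w := by
    intro t e w q
    unfold hbRow
    split_ifs
    · rw [map_mul, map_mul]
      exact mul_le_mul (hsu _ _ _) (hsu _ _ _) (apply_nonneg w _) (hsu0 _ _)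
    · have hneg : ∀ y : K, w (-y) = w y := fun y => w.1.map_neg y
      rw [map_neg, hneg, map_mul, map_mul]
      exact mul_le_mul (hsu _ _ _) (hsu _ _ _) (apply_nonneg w _) (hsu0 _ _)
  have hrowI : ∀ t e q, hbRow t e q ∈ sp t * sp e := by
    intro t e q
    unfold hbRow
    split_ifs
    · exact Ideal.mul_mem_mul (Ideal.subset_span ⟨_, rfl⟩) (Ideal.subset_span ⟨_, rfl⟩)
    · exact neg_mem (Ideal.mul_mem_mul (Ideal.subset_span ⟨_, rfl⟩) (Ideal.subset_span ⟨_, rfl⟩))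
  have hdet : ∀ (w : InfinitePlace K) (p q r : Fin 2 × Fin 2),
      w (algebraMap (𝓞 K) K (hbDet (hbRow t₁ e₁) (hbRow t₂ e₂) (hbRow t₃ e₃) p q r)) ≤
      6 * ((su t₁ w * su e₁ w) * (su t₂ w * su e₂ w) * (su t₃ w * su e₃ w)) := by
    intro w p q r
    have key : ∀ a b c, w (algebraMap (𝓞 K) K
        (hbRow t₁ e₁ a * hbRow t₂ e₂ b * hbRow t₃ e₃ c)) ≤
        (su t₁ w * su e₁ w) * (su t₂ w * su e₂ w) * (su t₃ w * su e₃ w) := by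
      intro a b c
      have n : ∀ t e, 0 ≤ su t w * su e w := fun t e => mul_nonneg (hsu0 _ _) (hsu0 _ _)
      rw [map_mul, map_mul, map_mul, map_mul]
      exact mul_le_mul (mul_le_mul (hrow _ _ _ _) (hrow _ _ _ _) (apply_nonneg w _) (n _ _))
        (hrow _ _ _ _) (apply_nonneg w _) (mul_nonneg (n _ _) (n _ _))
    have hadd : ∀ x y : K, w (x + y) ≤ w x + w y := fun x y => w.1.add_le x y
    have hsub : ∀ x y : K, w (x - y) ≤ w x + w y := fun x y => by
      have hneg : w (-y) = w y := w.1.map_neg y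
      rw [sub_eq_add_neg, ← hneg]
      exact hadd _ _
    unfold hbDet
    simp only [map_sub (algebraMap (𝓞 K) K), map_add (algebraMap (𝓞 K) K)]
    have k1 := key p q r
    have k2 := key p r q
    have k3 := key q p r
    have k4 := key q r p
    have k5 := key r p q
    have k6 := key r q p
    refine (hsub _ _).trans ?_
    refine (add_le_add_left (hadd _ _) _).trans ?_
    refine (add_le_add_left (add_le_add_left (hadd _ _) _) _).trans ?_
    refine (add_le_add_left (add_le_add_left (add_le_add_left (hsub _ _) _) _) _).trans ?_
    refine (add_le_add_left (add_le_add_left (add_le_add_left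
      (add_le_add_left (hsub _ _) _) _) _) _).trans ?_
    linarith
  have hdetI : ∀ (p q r : Fin 2 × Fin 2),
      hbDet (hbRow t₁ e₁) (hbRow t₂ e₂) (hbRow t₃ e₃) p q r ∈
      (sp t₁ * sp e₁) * (sp t₂ * sp e₂) * (sp t₃ * sp e₃) := by
    intro p q r
    have key : ∀ a b c, hbRow t₁ e₁ a * hbRow t₂ e₂ b * hbRow t₃ e₃ c ∈
        (sp t₁ * sp e₁) * (sp t₂ * sp e₂) * (sp t₃ * sp e₃) := fun a b c =>
      Ideal.mul_mem_mul (Ideal.mul_mem_mul (hrowI _ _ _) (hrowI _ _ _)) (hrowI _ _ _)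
    unfold hbDet
    exact sub_mem (add_mem (add_mem (sub_mem (sub_mem (key _ _ _) (key _ _ _)) (key _ _ _))
      (key _ _ _)) (key _ _ _)) (key _ _ _)
  have hmain := hb_le _ hm 6
    (fun w => (su t₁ w * su e₁ w) * (su t₂ w * su e₂ w) * (su t₃ w * su e₃ w))
    ((sp t₁ * sp e₁) * (sp t₂ * sp e₂) * (sp t₃ * sp e₃))
    (by
      intro w p
      have hneg : ∀ y : K, w (-y) = w y := fun y => w.1.map_neg y
      unfold hbMin
      split_ifs <;> first | exact hdet _ _ _ _ | (rw [map_neg, hneg]; exact hdet _ _ _ _))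
    (by
      intro p
      unfold hbMin
      split_ifs <;> first | exact hdetI _ _ _ | exact neg_mem (hdetI _ _ _))
  refine hmain.trans (le_of_eq ?_)
  simp only [mul_pow, Finset.prod_mul_distrib, map_mul, Nat.cast_mul]
  have hv : ∀ t, heightVec t = (∏ w, su t w ^ w.mult) / (Ideal.absNorm (sp t) : ℝ) :=
    fun t => rfl
  simp only [hv, div_eq_mul_inv, mul_inv]
  ring

lemma hb_matConj_map {R S : Type*} [CommRing R] [CommRing S] (f : R →+* S)
    (Φ Ψ : Fin 2 → MvPolynomial (Fin 2) R) (M : GL (Fin 2) R) (h : MatConj Φ Ψ M) :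
    MatConj (fun i => MvPolynomial.map f (Φ i)) (fun i => MvPolynomial.map f (Ψ i))
      (Matrix.GeneralLinearGroup.map f M) := by
  obtain ⟨c, hc⟩ := h
  refine ⟨Units.map f c, fun i => ?_⟩
  have hl : ∀ i, linForms (Matrix.GeneralLinearGroup.map f M : Matrix (Fin 2) (Fin 2) S) i =
      MvPolynomial.map f (linForms (M : Matrix (Fin 2) (Fin 2) R) i) := by
    intro i
    simp [linForms]
  have hl' : linForms (Matrix.GeneralLinearGroup.map f M : Matrix (Fin 2) (Fin 2) S) =
      fun i => MvPolynomial.map f (linForms (M : Matrix (Fin 2) (Fin 2) R) i) := funext hl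
  have := congrArg (MvPolynomial.map f) (hc i)
  rw [map_mul, MvPolynomial.map_bind₁, MvPolynomial.map_bind₁, MvPolynomial.map_C] at this
  rw [hl']
  exact this

lemma hb_br_ne {L : Type*} [Field L] (s t : Fin 2 → L) (ht : t ≠ 0)
    (h : ¬ ∃ c : L, s = c • t) : hbBr s t ≠ 0 := by
  intro h0
  unfold hbBr at h0
  apply h
  by_cases h1 : t 0 = 0
  · have h2 : t 1 ≠ 0 := by
      intro h2
      apply ht
      funext i
      fin_cases i <;> simp [h1, h2]
    refine ⟨s 1 / t 1, ?_⟩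
    have : s 0 = 0 := by
      rw [h1] at h0
      simpa [h2] using h0
    funext i
    fin_cases i
    · simp [h1, this]
    · simp [h2]
  · refine ⟨s 0 / t 0, ?_⟩
    funext i
    fin_cases i
    · simp [h1]
    · simp
      field_simp
      linear_combination -h0

end Helpers

/-- height bound for the elements of `Conj_{φ,ψ}(K)`.  The
invariant pair `T_φ, T_ψ ⊂ ℙ¹(K̄)` is represented by integral vectors over a
finite extension `L/K`, invariance being required for every conjugating map
over the algebraic closure `K̄ = AlgebraicClosure L`; heights are compared after
raising to the power `[L:K]`, via `H_K = H_L^{1/[L:K]}`. -/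
theorem height_bound_for_conjugating_maps
    {K L : Type*} [Field K] [NumberField K] [Field L] [NumberField L]
    [Algebra K L]
    (d : ℕ) (hd : 2 ≤ d)
    (Φ Ψ : Fin 2 → MvPolynomial (Fin 2) K)
    (hhomΦ : ∀ i, (Φ i).IsHomogeneous d) (hrelΦ : IsRelPrime (Φ 0) (Φ 1))
    (hhomΨ : ∀ i, (Ψ i).IsHomogeneous d) (hrelΨ : IsRelPrime (Ψ 0) (Ψ 1))
    (Tφ Tψ : Finset (Fin 2 → 𝓞 L)) (hTφ : Tφ.Nonempty) (hTψ : Tψ.Nonempty)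
    (hcard : Tφ.card = Tψ.card) (hcard3 : 3 ≤ Tφ.card)
    (hφ0 : ∀ w ∈ Tφ, (fun m => algebraMap (𝓞 L) L (w m)) ≠ 0)
    (hψ0 : ∀ w ∈ Tψ, (fun m => algebraMap (𝓞 L) L (w m)) ≠ 0)
    (hφdist : ∀ w ∈ Tφ, ∀ w' ∈ Tφ, w ≠ w' → ¬ ∃ c : L,
      (fun m => algebraMap (𝓞 L) L (w m)) =
        c • fun m => algebraMap (𝓞 L) L (w' m))
    (hψdist : ∀ w ∈ Tψ, ∀ w' ∈ Tψ, w ≠ w' → ¬ ∃ c : L,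
      (fun m => algebraMap (𝓞 L) L (w m)) =
        c • fun m => algebraMap (𝓞 L) L (w' m))
    -- Galois stability of the pair
    (hφgal : ∀ (σ : L ≃ₐ[K] L), ∀ w ∈ Tφ, ∃ w' ∈ Tφ, ∃ c : Lˣ,
      (fun m => σ (algebraMap (𝓞 L) L (w m))) =
        c • fun m => algebraMap (𝓞 L) L (w' m))
    (hψgal : ∀ (σ : L ≃ₐ[K] L), ∀ w ∈ Tψ, ∃ w' ∈ Tψ, ∃ c : Lˣ,
      (fun m => σ (algebraMap (𝓞 L) L (w m))) =
        c • fun m => algebraMap (𝓞 L) L (w' m))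
    -- invariance: every conjugating map over K̄ = AlgebraicClosure L maps T_φ onto T_ψ
    (hinv : ∀ Mc : GL (Fin 2) (AlgebraicClosure L),
      MatConj
        (fun i => MvPolynomial.map
          ((algebraMap L (AlgebraicClosure L)).comp (algebraMap K L)) (Φ i))
        (fun i => MvPolynomial.map
          ((algebraMap L (AlgebraicClosure L)).comp (algebraMap K L)) (Ψ i)) Mc →
      (∀ w ∈ Tφ, ∃ w' ∈ Tψ, ∃ c : (AlgebraicClosure L)ˣ,
        ((Mc : Matrix (Fin 2) (Fin 2) (AlgebraicClosure L)).mulVec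
          fun m => algebraMap L (AlgebraicClosure L) (algebraMap (𝓞 L) L (w m))) =
            c • fun m => algebraMap L (AlgebraicClosure L) (algebraMap (𝓞 L) L (w' m))) ∧
      (∀ w' ∈ Tψ, ∃ w ∈ Tφ, ∃ c : (AlgebraicClosure L)ˣ,
        ((Mc : Matrix (Fin 2) (Fin 2) (AlgebraicClosure L)).mulVec
          fun m => algebraMap L (AlgebraicClosure L) (algebraMap (𝓞 L) L (w m))) =
            c • fun m => algebraMap L (AlgebraicClosure L) (algebraMap (𝓞 L) L (w' m)))) :
    ∀ s ∈ ConjSet Φ Ψ, ∀ (M : GL (Fin 2) K)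
        (N : Matrix (Fin 2) (Fin 2) (𝓞 K)) (u : Kˣ),
      PGL2.mk M = s →
      (∀ i j, algebraMap (𝓞 K) K (N i j) =
        (u : K) * (M : Matrix (Fin 2) (Fin 2) K) i j) →
      heightVec (fun p : Fin 2 × Fin 2 => N p.1 p.2) ^ Module.finrank K L ≤
        (6 : ℝ) ^ (Module.finrank ℚ K * Module.finrank K L) *
          (Tφ.sup' hTφ heightVec) ^ 3 * (Tψ.sup' hTψ heightVec) ^ 3 := by
  rintro s ⟨M', hM's, hconj⟩ M N u hMs hN
  obtain ⟨t₁, t₂, t₃, ht₁, ht₂, ht₃, h12, h13, h23⟩ := Finset.two_lt_card_iff.1 (by omega :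
    2 < Tφ.card)
  -- compare representatives
  have hz : M'⁻¹ * M ∈ Subgroup.center (GL (Fin 2) K) :=
    QuotientGroup.eq.1 (hM's.trans hMs.symm)
  obtain ⟨ζ, hζ⟩ := Matrix.GeneralLinearGroup.mem_center_iff_val_mem_range_scalar.1 hz
  have hMM : ∀ i j, (M : Matrix (Fin 2) (Fin 2) K) i j =
      ζ * (M' : Matrix (Fin 2) (Fin 2) K) i j := by
    intro i j
    have h1 : M = M' * (M'⁻¹ * M) := by group
    have h2 : (M : Matrix (Fin 2) (Fin 2) K) =
        (M' : Matrix (Fin 2) (Fin 2) K) * Matrix.scalar (Fin 2) ζ := by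
      rw [hζ, ← Units.val_mul, ← h1]
    rw [h2]
    simp [Matrix.scalar_apply, Matrix.mul_diagonal, mul_comm]
  have hN' : ∀ i j, algebraMap (𝓞 K) K (N i j) =
      (u * ζ) * (M' : Matrix (Fin 2) (Fin 2) K) i j := by
    intro i j
    rw [hN, hMM, mul_assoc]
  -- some entry of N is nonzero
  have hNne : ∃ p : Fin 2 × Fin 2, N p.1 p.2 ≠ 0 := by
    by_contra hcon
    push Not at hcon
    have h0 : (M : Matrix (Fin 2) (Fin 2) K) = 0 := by
      ext i j
      have := hN i j
      rw [hcon (i, j), map_zero] at this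
      simpa using this.symm
    have hdet := M.isUnit.map Matrix.detMonoidHom
    rw [h0] at hdet
    simp at hdet
  obtain ⟨p₀, hp₀⟩ := hNne
  -- pass to the algebraic closure
  let f : K →+* AlgebraicClosure L := (algebraMap L (AlgebraicClosure L)).comp (algebraMap K L)
  let g : 𝓞 L →+* AlgebraicClosure L :=
    (algebraMap L (AlgebraicClosure L)).comp (algebraMap (𝓞 L) L)
  have hg : Function.Injective g :=
    (algebraMap L (AlgebraicClosure L)).injective.comp (FaithfulSMul.algebraMap_injective (𝓞 L) L)
  obtain ⟨hinv1, -⟩ := hinv _ (hb_matConj_map f Φ Ψ M' hconj)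
  obtain ⟨e₁, he₁, c₁, hc₁⟩ := hinv1 t₁ ht₁
  obtain ⟨e₂, he₂, c₂, hc₂⟩ := hinv1 t₂ ht₂
  obtain ⟨e₃, he₃, c₃, hc₃⟩ := hinv1 t₃ ht₃
  set S := ((Matrix.GeneralLinearGroup.map f M' : GL (Fin 2) (AlgebraicClosure L)) :
    Matrix (Fin 2) (Fin 2) (AlgebraicClosure L)) with hS
  have hSdet : S.det ≠ 0 :=
    ((Matrix.GeneralLinearGroup.map f M').isUnit.map Matrix.detMonoidHom).ne_zero
  have hid := hbMin_identity S _ _ _ _ _ _ (c₁ : AlgebraicClosure L) c₂ c₃ hc₁ hc₂ hc₃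
  have hbr : ∀ w ∈ Tφ, ∀ w' ∈ Tφ, w ≠ w' →
      hbBr (fun m => algebraMap L (AlgebraicClosure L) (algebraMap (𝓞 L) L (w m)))
        (fun m => algebraMap L (AlgebraicClosure L) (algebraMap (𝓞 L) L (w' m))) ≠ 0 := by
    intro w hw w' hw' hne
    have h1 := hb_br_ne _ _ (hφ0 w' hw') (hφdist w hw w' hw' hne)
    have h2 := (map_ne_zero_iff _ (algebraMap L (AlgebraicClosure L)).injective).2 h1
    simpa [hbBr] using h2
  have hb12 := hbr _ ht₁ _ ht₂ h12
  have hb13 := hbr _ ht₁ _ ht₃ h13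
  have hb23 := hbr _ ht₂ _ ht₃ h23
  set m := hbMin (hbRow t₁ e₁) (hbRow t₂ e₂) (hbRow t₃ e₃) with hm
  let NL : Fin 2 × Fin 2 → 𝓞 L := fun p => algebraMap (𝓞 K) (𝓞 L) (N p.1 p.2)
  have hgm : ∀ p, g (m p) = hbMin
      (hbRow (fun m => algebraMap L (AlgebraicClosure L) (algebraMap (𝓞 L) L (t₁ m)))
        (fun m => algebraMap L (AlgebraicClosure L) (algebraMap (𝓞 L) L (e₁ m))))
      (hbRow (fun m => algebraMap L (AlgebraicClosure L) (algebraMap (𝓞 L) L (t₂ m)))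
        (fun m => algebraMap L (AlgebraicClosure L) (algebraMap (𝓞 L) L (e₂ m))))
      (hbRow (fun m => algebraMap L (AlgebraicClosure L) (algebraMap (𝓞 L) L (t₃ m)))
        (fun m => algebraMap L (AlgebraicClosure L) (algebraMap (𝓞 L) L (e₃ m)))) p :=
    fun p => hbMin_map g _ _ _ _ _ _ p
  have hgN : ∀ p, g (NL p) = f (u * ζ) * S p.1 p.2 := by
    intro p
    have h1 : g (NL p) = f (algebraMap (𝓞 K) K (N p.1 p.2)) := rfl
    rw [h1, hN', map_mul]
    rfl
  have hNL0 : NL p₀ ≠ 0 :=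
    (map_ne_zero_iff _ (FaithfulSMul.algebraMap_injective (𝓞 K) (𝓞 L))).2 hp₀
  have hgN0 : g (NL p₀) ≠ 0 := (map_ne_zero_iff _ hg).2 hNL0
  have hfu : f (u * ζ) ≠ 0 := by
    intro h
    rw [hgN, h, zero_mul] at hgN0
    exact hgN0 rfl
  have hS0 : S p₀.1 p₀.2 ≠ 0 := by
    intro h
    rw [hgN, h, mul_zero] at hgN0
    exact hgN0 rfl
  have hccc : (c₁ : AlgebraicClosure L) * c₂ * c₃ ≠ 0 :=
    mul_ne_zero (mul_ne_zero c₁.ne_zero c₂.ne_zero) c₃.ne_zero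
  have hm0 : m p₀ ≠ 0 := by
    intro h
    have h1 := hid p₀
    rw [← hgm, h, map_zero, mul_zero] at h1
    exact mul_ne_zero (mul_ne_zero (mul_ne_zero (mul_ne_zero hSdet hb12) hb13)
      hb23) hS0 h1.symm
  have hprop : (fun p => m p₀ * NL p) = fun p => NL p₀ * m p := by
    funext p
    apply hg
    rw [map_mul, map_mul, hgN, hgN]
    apply mul_left_cancel₀ hccc
    have h1 := hid p₀
    have h2 := hid p
    rw [← hgm] at h1 h2
    linear_combination (f (u * ζ) * S p.1 p.2) * h1 - (f (u * ζ) * S p₀.1 p₀.2) * h2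
  have hheight : heightVec (fun p : Fin 2 × Fin 2 => N p.1 p.2) ^ Module.finrank K L =
      heightVec m := by
    rw [← hb_base (L := L), ← hb_smul m (NL p₀) hNL0, ← hprop]
    exact (hb_smul NL (m p₀) hm0).symm
  rw [hheight, Module.finrank_mul_finrank ℚ K L]
  refine (hb_minors t₁ t₂ t₃ e₁ e₂ e₃ fun h => hm0 (congrFun h p₀)).trans ?_
  have hA : ∀ t ∈ Tφ, heightVec t ≤ Tφ.sup' hTφ heightVec := fun t ht => Finset.le_sup' _ ht
  have hB : ∀ t ∈ Tψ, heightVec t ≤ Tψ.sup' hTψ heightVec := fun t ht => Finset.le_sup' _ ht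
  have cube : ∀ (a b c X : ℝ), 0 ≤ a → 0 ≤ b → 0 ≤ c → a ≤ X → b ≤ X → c ≤ X →
      a * b * c ≤ X ^ 3 := by
    intro a b c X ha hb hc h1 h2 h3
    have hX : 0 ≤ X := ha.trans h1
    calc a * b * c ≤ X * X * X :=
          mul_le_mul (mul_le_mul h1 h2 hb hX) h3 hc (mul_nonneg hX hX)
      _ = X ^ 3 := by ring
  have hX0 : 0 ≤ Tφ.sup' hTφ heightVec := (hb_nonneg t₁).trans (hA _ ht₁)
  refine mul_le_mul (mul_le_mul_of_nonneg_left ?_ (by positivity)) ?_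
    (mul_nonneg (mul_nonneg (hb_nonneg _) (hb_nonneg _)) (hb_nonneg _)) (by positivity)
  · exact cube _ _ _ _ (hb_nonneg _) (hb_nonneg _) (hb_nonneg _) (hA _ ht₁) (hA _ ht₂) (hA _ ht₃)
  · exact cube _ _ _ _ (hb_nonneg _) (hb_nonneg _) (hb_nonneg _) (hB _ he₁) (hB _ he₂) (hB _ he₃)
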